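/- arXiv:2501.01571 — 2 statements merged into one kernel-verified Lean document; each statement's English description precedes it below -/
import Mathlib

section
/- The packing density of the set {0, 1, 4, 6} equals 1/7, i.e. d_p({0,1,4,6}) = 1/7; hence {0,1,4,6} achieves the minimum packing density among all sets of four integers. -/
open Pointwise Filter

/-- The difference set of `S`: `{s - t : s, t ∈ S, s ≥ t}`. -/
def diffSet (S : Set ℤ) : Set ℤ := {d | ∃ s ∈ S, ∃ t ∈ S, t ≤ s ∧ d = s - t}

/-- `A` is `S`-packing if translates `S + a₁` and `S + a₂` are disjoint for distinct `a₁, a₂ ∈ A`. -/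
def SPacking (S A : Set ℤ) : Prop :=
  ∀ a₁ ∈ A, ∀ a₂ ∈ A, a₁ ≠ a₂ →
    Disjoint ((fun s => s + a₁) '' S) ((fun s => s + a₂) '' S)

/-- Upper density of `A ⊆ ℤ`. -/
noncomputable def upperDensity (A : Set ℤ) : ℝ :=
  limsup (fun n : ℕ => ((A ∩ Set.Icc (-(n : ℤ)) (n : ℤ)).ncard : ℝ) / (2 * n + 1)) atTop

/-- Lower density of `A ⊆ ℤ`. -/
noncomputable def lowerDensity (A : Set ℤ) : ℝ :=
  liminf (fun n : ℕ => ((A ∩ Set.Icc (-(n : ℤ)) (n : ℤ)).ncard : ℝ) / (2 * n + 1)) atTop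

/-- Packing density of `S`: supremum of upper densities of `S`-packing sets. -/
noncomputable def packingDensity (S : Set ℤ) : ℝ :=
  sSup {d : ℝ | ∃ A : Set ℤ, SPacking S A ∧ d = upperDensity A}

/-- `t`, `A` are the sequences produced by the greedy packing algorithm for `S`:
`A₋₁ = ∅`, and for `i ≥ 0`, `tᵢ = min {x : x ≥ 0, x ∉ Aᵢ₋₁ + diff S}` and `Aᵢ = Aᵢ₋₁ ∪ {tᵢ}`. -/
def GreedySeq (S : Set ℤ) (t : ℕ → ℤ) (A : ℕ → Set ℤ) : Prop :=
  IsLeast {x : ℤ | 0 ≤ x ∧ x ∉ (∅ : Set ℤ) + diffSet S} (t 0) ∧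
  (∀ i : ℕ, IsLeast {x : ℤ | 0 ≤ x ∧ x ∉ A i + diffSet S} (t (i + 1))) ∧
  A 0 = (∅ : Set ℤ) ∪ {t 0} ∧
  (∀ i : ℕ, A (i + 1) = A i ∪ {t (i + 1)})

/-- `A` is `a`-forward-periodic with period `p`. -/
def FwdPeriodic (A : Set ℤ) (a p : ℤ) : Prop :=
  ∀ i : ℤ, 0 ≤ i → ((a + i ∈ A) ↔ (a + i + p ∈ A))

/-- Interval density of `A` restricted to `[a, b-1]`. -/
noncomputable def intervalDensity (A : Set ℤ) (a b : ℤ) : ℝ :=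
  ((A ∩ Set.Icc a (b - 1)).ncard : ℝ) / ((b : ℝ) - a)

/-- Membership in the set of naturals chosen greedily so that no two differ by an element of `E`. -/
def GreedyMem (E : Finset ℕ) (n : ℕ) : Prop :=
  ∀ m, (h : m < n) → GreedyMem E m → n - m ∉ E
termination_by n

lemma le_card_mul_card_greedyMem (E : Finset ℕ) (h0 : 0 ∈ E) (N : ℕ)
    [DecidablePred (GreedyMem E)] :
    N ≤ ((Finset.range N).filter (GreedyMem E)).card * E.card := by
  rw [← Finset.card_product]
  conv_lhs => rw [← Finset.card_range N]
  refine (Finset.card_le_card ?_).trans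
    (Finset.card_image_le (f := fun p : ℕ × ℕ => p.1 + p.2))
  intro x hx
  rw [Finset.mem_range] at hx
  simp only [Finset.mem_image, Finset.mem_product, Finset.mem_filter, Finset.mem_range,
    Prod.exists]
  by_cases hg : GreedyMem E x
  · exact ⟨x, 0, ⟨⟨hx, hg⟩, h0⟩, rfl⟩
  · rw [GreedyMem] at hg
    push Not at hg
    obtain ⟨m, hm, hgm, hE⟩ := hg
    exact ⟨m, x - m, ⟨⟨by omega, hgm⟩, hE⟩, by omega⟩

lemma exists_natAbs_sub_cover {S : Set ℤ} (hS : S.ncard = 4) :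
    ∃ E : Finset ℕ, 0 ∈ E ∧ E.card ≤ 7 ∧ ∀ s ∈ S, ∀ t ∈ S, (s - t).natAbs ∈ E := by
  obtain ⟨a, T, -, rfl, hT⟩ := Set.eq_insert_of_ncard_eq_succ hS
  obtain ⟨b, c, d, -, -, -, rfl⟩ := Set.ncard_eq_three.1 hT
  refine ⟨insert 0 {(a - b).natAbs, (a - c).natAbs, (a - d).natAbs, (b - c).natAbs,
    (b - d).natAbs, (c - d).natAbs}, by simp,
    (Finset.card_insert_le _ _).trans (Nat.succ_le_succ Finset.card_le_six), ?_⟩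
  have comm (x y : ℤ) : (x - y).natAbs = (y - x).natAbs := by rw [← Int.natAbs_neg, neg_sub]
  rintro s (rfl | rfl | rfl | rfl) t (rfl | rfl | rfl | rfl) <;> simp [comm]

lemma ncard_inter_Icc_le (A : Set ℤ) (n : ℕ) :
    (A ∩ Set.Icc (-(n : ℤ)) n).ncard ≤ 2 * n + 1 := by
  refine (Set.ncard_le_ncard Set.inter_subset_right (Set.finite_Icc _ _)).trans ?_
  rw [← Finset.coe_Icc, Set.ncard_coe_finset, Int.card_Icc]
  omega

lemma tendsto_const_add_div_atTop (a c : ℝ) :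
    Tendsto (fun n : ℕ => a + c / (2 * n + 1)) atTop (nhds a) := by
  have h : Tendsto (fun n : ℕ => (2 * n + 1 : ℝ)) atTop atTop :=
    tendsto_atTop_add_const_right _ _
      (tendsto_natCast_atTop_atTop.const_mul_atTop (by norm_num))
  simpa using (tendsto_const_nhds (x := c)).div_atTop h |>.const_add a

lemma upperDensity_le_of_ncard_le {A : Set ℤ} {a c : ℝ}
    (h : ∀ n : ℕ, ((A ∩ Set.Icc (-(n : ℤ)) n).ncard : ℝ) ≤ a * (2 * n + 1) + c) :
    upperDensity A ≤ a := by
  have ht := tendsto_const_add_div_atTop a c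
  rw [← ht.limsup_eq]
  refine limsup_le_limsup (Eventually.of_forall fun n => ?_) ?_ ht.isBoundedUnder_le
  · have hn : (0 : ℝ) < 2 * n + 1 := by positivity
    change _ / _ ≤ _
    rw [div_le_iff₀ hn, add_mul, div_mul_cancel₀ _ hn.ne']
    exact h n
  · exact isCoboundedUnder_le_of_le atTop (x := 0) fun n => by positivity

lemma le_upperDensity_of_le_ncard {A : Set ℤ} {a c : ℝ}
    (h : ∀ n : ℕ, a * (2 * n + 1) + c ≤ ((A ∩ Set.Icc (-(n : ℤ)) n).ncard : ℝ)) :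
    a ≤ upperDensity A := by
  have ht := tendsto_const_add_div_atTop a c
  rw [← ht.limsup_eq]
  refine limsup_le_limsup (Eventually.of_forall fun n => ?_) ht.isCoboundedUnder_le ?_
  · have hn : (0 : ℝ) < 2 * n + 1 := by positivity
    change _ ≤ _ / _
    rw [le_div_iff₀ hn, add_mul, div_mul_cancel₀ _ hn.ne']
    exact h n
  · refine isBoundedUnder_of ⟨1, fun n => ?_⟩
    exact div_le_one_of_le₀ (mod_cast ncard_inter_Icc_le A n) (by positivity)

lemma upperDensity_le_one (A : Set ℤ) : upperDensity A ≤ 1 :=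
  upperDensity_le_of_ncard_le (c := 0) fun n => by
    simpa using (mod_cast ncard_inter_Icc_le A n :
      ((A ∩ Set.Icc (-(n : ℤ)) n).ncard : ℝ) ≤ 2 * n + 1)

lemma upperDensity_le_packingDensity {S A : Set ℤ} (h : SPacking S A) :
    upperDensity A ≤ packingDensity S :=
  le_csSup ⟨1, by rintro _ ⟨B, -, rfl⟩; exact upperDensity_le_one B⟩ ⟨A, h, rfl⟩

/-- The greedy set on `ℕ` together with its reflection, separated by a gap of length `M`. -/
def reflectedGreedy (E : Finset ℕ) (M : ℕ) : Set ℤ :=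
  {z | ∃ a : ℕ, GreedyMem E a ∧ (z = a ∨ z = -a - M - 1)}

lemma GreedyMem.sub_notMem {E : Finset ℕ} {a b : ℕ} (ha : GreedyMem E a) (hb : GreedyMem E b)
    (hab : a < b) : b - a ∉ E := by
  rw [GreedyMem] at hb
  exact hb a hab ha

lemma natAbs_sub_notMem_of_reflectedGreedy {E : Finset ℕ} {M : ℕ} (hM : ∀ e ∈ E, e ≤ M) {x y : ℤ}
    (hx : x ∈ reflectedGreedy E M) (hy : y ∈ reflectedGreedy E M) (hxy : x ≠ y) :
    (x - y).natAbs ∉ E := by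
  have key {a b : ℕ} (ha : GreedyMem E a) (hb : GreedyMem E b) (hab : a ≠ b) :
      ((a : ℤ) - b).natAbs ∉ E := by
    rcases hab.lt_or_gt with h | h
    · rw [show ((a : ℤ) - b).natAbs = b - a by omega]
      exact ha.sub_notMem hb h
    · rw [show ((a : ℤ) - b).natAbs = a - b by omega]
      exact hb.sub_notMem ha h
  obtain ⟨a, ha, rfl | rfl⟩ := hx <;> obtain ⟨b, hb, rfl | rfl⟩ := hy
  · exact key ha hb (by omega)
  · exact fun h => by have := hM _ h; omega
  · exact fun h => by have := hM _ h; omega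
  · rw [show (-(a : ℤ) - M - 1 - (-b - M - 1)).natAbs = ((b : ℤ) - a).natAbs by omega]
    exact key hb ha (by omega)

lemma le_card_mul_ncard_reflectedGreedy (E : Finset ℕ) (h0 : 0 ∈ E) (M n : ℕ) :
    2 * n + 1 ≤ (reflectedGreedy E M ∩ Set.Icc (-(n : ℤ)) n).ncard * E.card + M := by
  classical
  set P := ((Finset.range (n + 1)).filter (GreedyMem E)).image (fun a : ℕ => (a : ℤ)) with hP
  set Q := ((Finset.range (n - M)).filter (GreedyMem E)).image
    (fun a : ℕ => -(a : ℤ) - M - 1) with hQ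
  have hPc := Finset.card_image_of_injective ((Finset.range (n + 1)).filter (GreedyMem E))
    (f := fun a : ℕ => (a : ℤ)) (fun a b h => by simpa using h)
  have hQc := Finset.card_image_of_injective ((Finset.range (n - M)).filter (GreedyMem E))
    (f := fun a : ℕ => -(a : ℤ) - M - 1) (fun a b h => by simpa using h)
  have hdisj : Disjoint P Q := by
    rw [Finset.disjoint_left]
    intro x hx hy
    simp only [hP, hQ, Finset.mem_image] at hx hy
    obtain ⟨a, -, rfl⟩ := hx
    obtain ⟨b, -, h⟩ := hy
    omega
  have hsub : (↑(P ∪ Q) : Set ℤ) ⊆ reflectedGreedy E M ∩ Set.Icc (-(n : ℤ)) n := by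
    intro x hx
    simp only [hP, hQ, Finset.coe_union, Finset.coe_image, Set.mem_union, Set.mem_image,
      Finset.mem_coe, Finset.mem_filter, Finset.mem_range] at hx
    rcases hx with ⟨a, ⟨ha, hg⟩, rfl⟩ | ⟨a, ⟨ha, hg⟩, rfl⟩
    · exact ⟨⟨a, hg, .inl rfl⟩, Set.mem_Icc.2 (by omega)⟩
    · exact ⟨⟨a, hg, .inr rfl⟩, Set.mem_Icc.2 (by omega)⟩
  have hcard := Set.ncard_le_ncard hsub ((Set.finite_Icc _ _).subset Set.inter_subset_right)
  rw [Set.ncard_coe_finset, Finset.card_union_of_disjoint hdisj, hPc, hQc] at hcard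
  have hmul := Nat.mul_le_mul_right E.card hcard
  rw [add_mul] at hmul
  have h1 := le_card_mul_card_greedyMem E h0 (n + 1)
  have h2 := le_card_mul_card_greedyMem E h0 (n - M)
  omega

theorem one_div_seven_le_packingDensity {S : Set ℤ} (hS : S.ncard = 4) :
    1 / 7 ≤ packingDensity S := by
  obtain ⟨E, h0, hE, hSE⟩ := exists_natAbs_sub_cover hS
  set M := E.sup id
  have hpack : SPacking S (reflectedGreedy E M) := by
    intro x hx y hy hxy
    rw [Set.disjoint_left]
    rintro _ ⟨s, hs, rfl⟩ ⟨t, ht, h⟩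
    refine natAbs_sub_notMem_of_reflectedGreedy (fun e he => Finset.le_sup (f := id) he)
      hx hy hxy ?_
    convert hSE t ht s hs using 2
    simp only at h
    omega
  refine le_trans ?_ (upperDensity_le_packingDensity hpack)
  refine le_upperDensity_of_le_ncard (c := -M / 7) fun n => ?_
  have h := (le_card_mul_ncard_reflectedGreedy E h0 M n).trans
    (Nat.add_le_add_right (Nat.mul_le_mul_left _ hE) M)
  have h' : (2 * n + 1 : ℝ) ≤
      (reflectedGreedy E M ∩ Set.Icc (-(n : ℤ)) n).ncard * 7 + M := mod_cast h
  linarith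

lemma SPacking.seven_le_sub {A : Set ℤ} (hA : SPacking {0, 1, 4, 6} A) {x y : ℤ}
    (hx : x ∈ A) (hy : y ∈ A) (hxy : x < y) : 7 ≤ y - x := by
  have hd := hA x hx y hy hxy.ne
  have key (s t : ℤ) (hs : s ∈ ({0, 1, 4, 6} : Set ℤ)) (ht : t ∈ ({0, 1, 4, 6} : Set ℤ)) :
      t + x ≠ s + y := fun h =>
    Set.disjoint_left.1 hd ⟨t, ht, rfl⟩ ⟨s, hs, h.symm⟩
  have h1 := key 0 1 (by simp) (by simp)
  have h2 := key 4 6 (by simp) (by simp)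
  have h3 := key 1 4 (by simp) (by simp)
  have h4 := key 0 4 (by simp) (by simp)
  have h5 := key 1 6 (by simp) (by simp)
  have h6 := key 0 6 (by simp) (by simp)
  omega

lemma SPacking.upperDensity_le_one_div_seven {A : Set ℤ} (hA : SPacking {0, 1, 4, 6} A) :
    upperDensity A ≤ 1 / 7 := by
  refine upperDensity_le_of_ncard_le (c := 1) fun n => ?_
  have hcard : (A ∩ Set.Icc (-(n : ℤ)) n).ncard ≤ 2 * n / 7 + 1 := by
    have h := Set.ncard_le_ncard_of_injOn (s := A ∩ Set.Icc (-(n : ℤ)) n)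
      (t := ↑(Finset.range (2 * n / 7 + 1))) (fun x => ((x + n) / 7).toNat) ?_ ?_
      (Finset.finite_toSet _)
    · rwa [Set.ncard_coe_finset, Finset.card_range] at h
    · rintro x ⟨-, hx⟩
      rw [Set.mem_Icc] at hx
      simp only [Finset.coe_range, Set.mem_Iio]
      omega
    · rintro x ⟨hxA, hx⟩ y ⟨hyA, hy⟩ hxy
      rw [Set.mem_Icc] at hx hy
      simp only at hxy
      by_contra hne
      rcases lt_or_gt_of_ne hne with h | h
      · have := hA.seven_le_sub hxA hyA h
        omega
      · have := hA.seven_le_sub hyA hxA h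
        omega
  have h7 : (A ∩ Set.Icc (-(n : ℤ)) n).ncard * 7 ≤ 2 * n + 1 + 7 := by omega
  have h7' : ((A ∩ Set.Icc (-(n : ℤ)) n).ncard * 7 : ℝ) ≤ 2 * n + 1 + 7 := mod_cast h7
  linarith

theorem packingDensity_zero_one_four_six : packingDensity {0, 1, 4, 6} = 1 / 7 := by
  refine le_antisymm (csSup_le ⟨_, ∅, by simp [SPacking], rfl⟩ ?_)
    (one_div_seven_le_packingDensity ?_)
  · rintro _ ⟨A, hA, rfl⟩
    exact hA.upperDensity_le_one_div_seven
  · have : ({0, 1, 4, 6} : Set ℤ) = ↑({0, 1, 4, 6} : Finset ℤ) := by simp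
    rw [this, Set.ncard_coe_finset]
    rfl

theorem stmt12 :
    packingDensity {0, 1, 4, 6} = 1 / 7 ∧
    ∀ S : Set ℤ, S.ncard = 4 → packingDensity {0, 1, 4, 6} ≤ packingDensity S := by
  exact ⟨packingDensity_zero_one_four_six, fun S hS =>
    packingDensity_zero_one_four_six.trans_le (one_div_seven_le_packingDensity hS)⟩
end

section
/- Let S ⊆ ℤ be a finite nonempty set, let {A_i} be the sequence of sets produced by the greedy packing algorithm for S, and let A_∞ = ⋃_{i ≥ 0} A_i. Then for all n ≥ 1, |A_∞ ∩ [0, n-1]| ≥ n / |diff(S)|; equivalently, the interval density satisfies d(A_∞, 0, n) ≥ 1/|diff(S)| for all n ≥ 1. -/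
open Pointwise Filter

theorem diffSet_finite {S : Set ℤ} (hS : S.Finite) : (diffSet S).Finite := by
  refine (hS.sub hS).subset ?_
  rintro d ⟨s, hs, t, ht, -, rfl⟩
  exact Set.sub_mem_sub hs ht

theorem zero_mem_diffSet {S : Set ℤ} (hS : S.Nonempty) : (0 : ℤ) ∈ diffSet S := by
  obtain ⟨s, hs⟩ := hS
  exact ⟨s, hs, s, hs, le_rfl, by simp⟩

theorem nonneg_of_mem_diffSet {S : Set ℤ} {d : ℤ} (hd : d ∈ diffSet S) : 0 ≤ d := by
  obtain ⟨s, -, t, -, hts, rfl⟩ := hd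
  omega

namespace GreedySeq

variable {S : Set ℤ} {t : ℕ → ℤ} {A : ℕ → Set ℤ}

theorem nonneg (hg : GreedySeq S t A) (i : ℕ) : 0 ≤ t i := by
  cases i with
  | zero => exact hg.1.1.1
  | succ i => exact (hg.2.1 i).1.1

theorem mem_iff (hg : GreedySeq S t A) (i : ℕ) (x : ℤ) : x ∈ A i ↔ ∃ j ≤ i, t j = x := by
  induction i with
  | zero => simp [hg.2.2.1, eq_comm]
  | succ i ih =>
    rw [hg.2.2.2 i, Set.mem_union, ih, Set.mem_singleton_iff]
    constructor
    · rintro (⟨j, hj, rfl⟩ | rfl)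
      · exact ⟨j, by omega, rfl⟩
      · exact ⟨i + 1, le_rfl, rfl⟩
    · rintro ⟨j, hj, rfl⟩
      rcases Nat.le_succ_iff.mp hj with h | rfl
      · exact Or.inl ⟨j, h, rfl⟩
      · exact Or.inr rfl

theorem injective (hg : GreedySeq S t A) (hS : S.Nonempty) : Function.Injective t := by
  refine .of_lt_imp_ne fun i j hij h => ?_
  obtain ⟨k, rfl⟩ : ∃ k, j = k + 1 := ⟨j - 1, by omega⟩
  refine (hg.2.1 k).1.2 ?_
  rw [← h, ← add_zero (t i)]
  exact Set.add_mem_add ((hg.mem_iff k _).2 ⟨i, by omega, rfl⟩) (zero_mem_diffSet hS)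

theorem exists_mem_add_diffSet (hg : GreedySeq S t A) (hS : S.Nonempty) {x : ℤ} (hx : 0 ≤ x) :
    ∃ i, x ∈ A i + diffSet S := by
  by_contra! h
  have hle : ∀ i, t (i + 1) ≤ x := fun i => (hg.2.1 i).2 ⟨hx, h i⟩
  refine Set.infinite_of_injective_forall_mem (f := fun i => t (i + 1)) ?_
    (fun i => Set.mem_Icc.2 ⟨hg.nonneg (i + 1), hle i⟩) (Set.finite_Icc 0 x)
  exact (hg.injective hS).comp (add_left_injective 1)

theorem Icc_subset_add_diffSet (hg : GreedySeq S t A) (hS : S.Nonempty) (b : ℤ) :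
    Set.Icc 0 b ⊆ ((⋃ i, A i) ∩ Set.Icc 0 b) + diffSet S := by
  rintro x ⟨hx, hxb⟩
  obtain ⟨i, a, ha, d, hd, rfl⟩ := hg.exists_mem_add_diffSet hS hx
  obtain ⟨j, -, rfl⟩ := (hg.mem_iff i a).1 ha
  have hd0 := nonneg_of_mem_diffSet hd
  exact Set.add_mem_add
    ⟨Set.mem_iUnion.2 ⟨i, ha⟩, hg.nonneg j, by dsimp only at hxb; omega⟩ hd

theorem le_ncard_mul_ncard (hg : GreedySeq S t A) (hfin : S.Finite) (hS : S.Nonempty) (n : ℕ) :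
    n ≤ ((⋃ i, A i) ∩ Set.Icc 0 ((n : ℤ) - 1)).ncard * (diffSet S).ncard := by
  have hF : ((⋃ i, A i) ∩ Set.Icc 0 ((n : ℤ) - 1)).Finite :=
    (Set.finite_Icc _ _).subset Set.inter_subset_right
  calc n = (Set.Icc 0 ((n : ℤ) - 1)).ncard := by
        rw [← Finset.coe_Icc, Set.ncard_coe_finset, Int.card_Icc]; simp
    _ ≤ _ := Set.ncard_le_ncard (hg.Icc_subset_add_diffSet hS _) (hF.add (diffSet_finite hfin))
    _ ≤ _ := Set.natCard_add_le

end GreedySeq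

theorem stmt16 (S : Set ℤ) (hfin : S.Finite) (hne : S.Nonempty)
    (t : ℕ → ℤ) (A : ℕ → Set ℤ) (hg : GreedySeq S t A)
    (Ainf : Set ℤ) (hAinf : Ainf = ⋃ i : ℕ, A i) :
    ∀ n : ℕ, 1 ≤ n →
      (n : ℝ) / ((diffSet S).ncard : ℝ) ≤ ((Ainf ∩ Set.Icc 0 ((n : ℤ) - 1)).ncard : ℝ) ∧
      1 / ((diffSet S).ncard : ℝ) ≤ intervalDensity Ainf 0 (n : ℤ) := by
  intro n hn
  subst hAinf
  have hD : (0 : ℝ) < ((diffSet S).ncard : ℝ) := by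
    exact_mod_cast (Set.ncard_pos (diffSet_finite hfin)).2 ⟨0, zero_mem_diffSet hne⟩
  have hn0 : (0 : ℝ) < n := by exact_mod_cast hn
  have key : (n : ℝ) ≤ (((⋃ i, A i) ∩ Set.Icc 0 ((n : ℤ) - 1)).ncard : ℝ) *
      ((diffSet S).ncard : ℝ) := by
    exact_mod_cast hg.le_ncard_mul_ncard hfin hne n
  refine ⟨(div_le_iff₀ hD).2 key, ?_⟩
  rw [intervalDensity, Int.cast_natCast, Int.cast_zero, sub_zero, div_le_div_iff₀ hD hn0, one_mul]
  exact key
end
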